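/- arXiv:2111.09053 — 6 statements merged into one kernel-verified Lean document; each statement's English description precedes it below -/
import Mathlib

section
/- For every positive integer n, φ₂(n) = n · (1 − θ_n/2) · ∏_{p | n, p odd prime} (1 − 2/p), where θ_n = 0 if n is odd and θ_n = 1 if n is even. -/
/-- The modified totient function `φ₂`. -/
def phi2 (n : ℕ) : ℕ :=
  ((Finset.Icc 1 n).filter (fun a => Nat.gcd a n = 1 ∧ Nat.gcd (a + 2) n = 1)).card

theorem phi2_eq_count (n : ℕ) :
    phi2 n = n.count (fun a => Nat.gcd a n = 1 ∧ Nat.gcd (a + 2) n = 1) := by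
  have hper : Function.Periodic
      (fun a => Nat.gcd a n = 1 ∧ Nat.gcd (a + 2) n = 1) n := by
    intro a
    simp [add_right_comm a n 2]
  rw [← Nat.filter_Ico_card_eq_of_periodic 1 n _ hper, phi2]
  congr 2
  ext a
  simp only [Finset.mem_Icc, Finset.mem_Ico]
  omega

theorem phi2_mul {m n : ℕ} (hm : 0 < m) (hn : 0 < n) (h : m.Coprime n) :
    phi2 (m * n) = phi2 m * phi2 n := by
  simp only [phi2_eq_count, Nat.count_eq_card_filter_range]
  rw [← Finset.card_product]
  have mod_gcd (a b k : ℕ) : Nat.gcd (a % k + b) k = Nat.gcd (a + b) k :=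
    ((Nat.mod_modEq a k).add_right b).gcd_eq
  refine Finset.card_bij (fun a _ => (a % m, a % n)) ?_ ?_ ?_
  · intro a ha
    simp only [Finset.mem_filter, Finset.mem_range, Finset.mem_product] at ha ⊢
    have h₀ := Nat.coprime_mul_iff_right.1 ha.2.1
    have h₂ := Nat.coprime_mul_iff_right.1 ha.2.2
    exact ⟨⟨Nat.mod_lt _ hm, (mod_gcd a 0 m).trans h₀.1, (mod_gcd a 2 m).trans h₂.1⟩,
      ⟨Nat.mod_lt _ hn, (mod_gcd a 0 n).trans h₀.2, (mod_gcd a 2 n).trans h₂.2⟩⟩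
  · intro a ha b hb hab
    simp only [Finset.mem_filter, Finset.mem_range] at ha hb
    simp only [Prod.mk.injEq] at hab
    exact ((Nat.modEq_and_modEq_iff_modEq_mul h).1 hab).eq_of_lt_of_lt ha.1 hb.1
  · rintro ⟨x, y⟩ hxy
    simp only [Finset.mem_filter, Finset.mem_range, Finset.mem_product] at hxy
    obtain ⟨⟨hx, hx₀, hx₂⟩, hy, hy₀, hy₂⟩ := hxy
    obtain ⟨c, hcx, hcy⟩ := Nat.chineseRemainder h x y
    have hmn : c % (m * n) ≡ c [MOD m * n] := Nat.mod_modEq _ _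
    have h₁ : c % (m * n) ≡ x [MOD m] := hmn.of_mul_right n |>.trans hcx
    have h₂ : c % (m * n) ≡ y [MOD n] := hmn.of_mul_left m |>.trans hcy
    refine ⟨c % (m * n), ?_, ?_⟩
    · simp only [Finset.mem_filter, Finset.mem_range]
      refine ⟨Nat.mod_lt _ (Nat.mul_pos hm hn), Nat.coprime_mul_iff_right.2 ⟨?_, ?_⟩,
        Nat.coprime_mul_iff_right.2 ⟨?_, ?_⟩⟩
      · exact h₁.gcd_eq.trans hx₀
      · exact h₂.gcd_eq.trans hy₀
      · exact (h₁.add_right 2).gcd_eq.trans hx₂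
      · exact (h₂.add_right 2).gcd_eq.trans hy₂
    · exact Prod.ext (Nat.mod_eq_of_modEq h₁ hx) (Nat.mod_eq_of_modEq h₂ hy)

theorem count_mul_of_periodic {P : ℕ → Prop} [DecidablePred P] {k : ℕ}
    (hP : Function.Periodic P k) (m : ℕ) : (m * k).count P = m * k.count P := by
  induction m with
  | zero => simp
  | succ m ih =>
    have h : (fun j => P (m * k + j)) = P := by
      funext j
      rw [add_comm]
      exact hP.nat_mul m j
    rw [Nat.succ_mul, Nat.count_add, ih, Nat.succ_mul]
    simp only [h]

theorem phi2_pow_succ (p k : ℕ) :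
    phi2 (p ^ (k + 1)) = p ^ k * phi2 p := by
  have hper : Function.Periodic
      (fun a => Nat.gcd a p = 1 ∧ Nat.gcd (a + 2) p = 1) p := by
    intro a
    simp [add_right_comm a p 2]
  have hiff (a : ℕ) : Nat.gcd a (p ^ (k + 1)) = 1 ↔ Nat.gcd a p = 1 :=
    Nat.coprime_pow_right_iff k.succ_pos a p
  simp only [phi2_eq_count, hiff]
  rw [← count_mul_of_periodic hper, pow_succ]

theorem phi2_two : phi2 2 = 1 := by decide

theorem phi2_prime {p : ℕ} (hp : p.Prime) (h2 : p ≠ 2) : phi2 p = p - 2 := by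
  have h2p : 2 < p := lt_of_le_of_ne hp.two_le h2.symm
  rw [phi2_eq_count, Nat.count_eq_card_filter_range]
  have hset : (Finset.range p).filter (fun a => Nat.gcd a p = 1 ∧ Nat.gcd (a + 2) p = 1) =
      Finset.range p \ {0, p - 2} := by
    ext a
    have hiff (b : ℕ) : Nat.gcd b p = 1 ↔ ¬ p ∣ b := by
      rw [Nat.gcd_comm]
      exact hp.coprime_iff_not_dvd
    simp only [Finset.mem_filter, Finset.mem_range, Finset.mem_sdiff, Finset.mem_insert,
      Finset.mem_singleton, hiff, not_or]
    refine and_congr_right fun ha => and_congr (not_congr ?_) (not_congr ?_)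
    · exact ⟨fun h => Nat.eq_zero_of_dvd_of_lt h ha, fun h => h ▸ dvd_zero p⟩
    · constructor
      · rintro ⟨c, hc⟩
        have hc1 : c = 1 := by
          have : c < 2 := by nlinarith
          have : c ≠ 0 := by rintro rfl; omega
          omega
        subst hc1
        omega
      · intro h
        exact ⟨1, by omega⟩
  rw [hset, Finset.card_sdiff_of_subset, Finset.card_range, Finset.card_pair (by omega)]
  intro a
  simp only [Finset.mem_insert, Finset.mem_singleton, Finset.mem_range]
  omega

theorem phi2_eq_mul_prod_primeFactors (n : ℕ) (hn : 0 < n) :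
    (phi2 n : ℚ) =
      n * ∏ p ∈ n.primeFactors, if p = 2 then (1 / 2 : ℚ) else 1 - 2 / (p : ℚ) := by
  induction n using Nat.recOnPosPrimePosCoprime with
  | zero => omega
  | one => simp [phi2]
  | prime_pow p k hp hk =>
    obtain ⟨k, rfl⟩ := Nat.exists_eq_succ_of_ne_zero hk.ne'
    have hp0 : (p : ℚ) ≠ 0 := Nat.cast_ne_zero.2 hp.ne_zero
    rw [Nat.primeFactors_prime_pow k.succ_ne_zero hp, Finset.prod_singleton, Nat.succ_eq_add_one,
      phi2_pow_succ]
    split_ifs with h2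
    · subst h2
      rw [phi2_two]
      push_cast
      ring
    · rw [phi2_prime hp h2]
      push_cast [hp.two_le]
      field_simp
      ring
  | coprime a b ha hb hab iha ihb =>
    rw [phi2_mul (by omega) (by omega) hab, hab.primeFactors_mul,
      Finset.prod_union hab.disjoint_primeFactors]
    push_cast
    rw [iha (by omega), ihb (by omega)]
    ring

/-- `φ₂(n) = n (1 - θ_n/2) ∏_{p ∣ n, p odd prime} (1 - 2/p)` where
`θ_n = 0` for odd `n` and `θ_n = 1` for even `n`. -/
theorem phi2_product_formula (n : ℕ) (hn : 0 < n) :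
    (phi2 n : ℚ) =
      n * (1 - (if Even n then 1 else 0) / 2) *
        ∏ p ∈ n.primeFactors.filter (fun p => p ≠ 2), (1 - 2 / (p : ℚ)) := by
  rw [phi2_eq_mul_prod_primeFactors n hn, mul_assoc, Finset.prod_ite, Finset.prod_const]
  congr 2
  have hmem : 2 ∈ n.primeFactors ↔ Even n := by
    simp [Nat.prime_two, even_iff_two_dvd, hn.ne']
  rw [Finset.filter_eq']
  simp only [hmem]
  split_ifs <;> norm_num
end

section
/- For every positive integer n, φ₂(n) = n · ∑_{d | n} μ₂(d)/d. -/
/-- The modified Möbius function `μ₂(n) = μ(n)·2^{ω_o(n)}`, where `ω_o(n)` is the number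
of distinct odd prime divisors of `n`. -/
noncomputable def mu2 (n : ℕ) : ℤ :=
  ArithmeticFunction.moebius n * 2 ^ (n.primeFactors.filter (· ≠ 2)).card

/-- The number of residues `x` modulo `d` with `x * (x + 2) = 0`. -/
noncomputable def rootCount (d : ℕ) : ℕ :=
  Nat.card {x : ZMod d // x * (x + 2) = 0}

theorem rootCount_mul {a b : ℕ} (h : a.Coprime b) :
    rootCount (a * b) = rootCount a * rootCount b := by
  unfold rootCount
  rw [← Nat.card_prod]
  refine Nat.card_congr ((Equiv.subtypeEquiv (q := fun y : ZMod a × ZMod b =>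
    y.1 * (y.1 + 2) = 0 ∧ y.2 * (y.2 + 2) = 0) (ZMod.chineseRemainder h).toEquiv ?_).trans
    (Equiv.subtypeProdEquivProd (p := fun x : ZMod a => x * (x + 2) = 0)
      (q := fun x : ZMod b => x * (x + 2) = 0)))
  intro x
  rw [← (ZMod.chineseRemainder h).map_eq_zero_iff, map_mul, map_add, map_ofNat, Prod.ext_iff]
  rfl

theorem rootCount_one : rootCount 1 = 1 := by
  unfold rootCount
  rw [Nat.card_eq_one_iff_unique]
  exact ⟨inferInstance, ⟨⟨0, by simp⟩⟩⟩

theorem rootCount_two : rootCount 2 = 1 := by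
  unfold rootCount
  rw [Nat.card_eq_fintype_card]
  decide

theorem rootCount_prime {p : ℕ} (hp : p.Prime) (h2 : p ≠ 2) : rootCount p = 2 := by
  have := Fact.mk hp
  have hne : (0 : ZMod p) ≠ -2 := by
    intro h
    have h' : ((2 : ℕ) : ZMod p) = 0 := by
      push_cast
      linear_combination h
    rw [ZMod.natCast_eq_zero_iff] at h'
    exact h2 ((Nat.prime_dvd_prime_iff_eq hp Nat.prime_two).1 h')
  have hs : {x : ZMod p | x * (x + 2) = 0} = {0, -2} := by
    ext x
    simp [eq_neg_iff_add_eq_zero]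
  change Nat.card ({x : ZMod p | x * (x + 2) = 0} : Set (ZMod p)) = 2
  rw [hs, Nat.card_coe_set_eq, Set.ncard_pair hne]

theorem rootCount_of_squarefree {d : ℕ} (hd : Squarefree d) :
    rootCount d = 2 ^ (d.primeFactors.filter (· ≠ 2)).card := by
  induction d using Nat.recOnPosPrimePosCoprime with
  | zero => exact absurd hd not_squarefree_zero
  | one => simp [rootCount_one]
  | prime_pow p n hp hn =>
    obtain rfl : n = 1 := ((Nat.squarefree_pow_iff hp.ne_one hn.ne').1 hd).2
    rw [pow_one, hp.primeFactors]
    by_cases h2 : p = 2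
    · subst h2
      simp [rootCount_two, Finset.filter_singleton]
    · simp [rootCount_prime hp h2, Finset.filter_singleton, h2]
  | coprime a b _ _ hab iha ihb =>
    rw [rootCount_mul hab, iha hd.of_mul_left, ihb hd.of_mul_right, ← pow_add,
      hab.primeFactors_mul, Finset.filter_union, Finset.card_union_of_disjoint]
    exact Finset.disjoint_filter_filter hab.disjoint_primeFactors

theorem count_dvd_eq_rootCount {d : ℕ} (hd : 0 < d) :
    Nat.count (fun a => d ∣ a * (a + 2)) d = rootCount d := by
  have := NeZero.of_pos hd
  unfold rootCount
  rw [Nat.count_eq_card_filter_range, Nat.card_eq_fintype_card, Fintype.card_subtype]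
  refine Finset.card_nbij' (fun a => (a : ZMod d)) ZMod.val ?_ ?_ ?_ ?_
  · intro a ha
    have := (ZMod.natCast_eq_zero_iff _ d).2 (Finset.mem_filter.1 ha).2
    simpa using this
  · intro x hx
    have hx' : x * (x + 2) = 0 := by simpa using hx
    simp only [Finset.coe_filter, Finset.mem_range, Set.mem_ofPred_eq]
    refine ⟨x.val_lt, (ZMod.natCast_eq_zero_iff _ d).1 ?_⟩
    simpa using hx'
  · intro a ha
    exact ZMod.val_cast_of_lt (Finset.mem_range.1 (Finset.mem_filter.1 ha).1)
  · intro x _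
    exact ZMod.natCast_zmod_val x

theorem count_dvd_mul {d : ℕ} (hd : 0 < d) (m : ℕ) :
    Nat.count (fun a => d ∣ a * (a + 2)) (d * m) = m * rootCount d := by
  induction m with
  | zero => simp
  | succ m ih =>
    have hper : (fun k => d ∣ (d * m + k) * (d * m + k + 2)) = fun k => d ∣ k * (k + 2) := by
      funext k
      rw [show (d * m + k) * (d * m + k + 2) = d * (m * (d * m + k + 2) + k * m) + k * (k + 2) by
        ring, Nat.dvd_add_right (Dvd.intro _ rfl)]
    rw [Nat.mul_succ, Nat.count_add, ih]
    simp only [hper]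
    rw [count_dvd_eq_rootCount hd]
    ring

theorem card_Icc_filter_dvd {d n : ℕ} (hn : 0 < n) (hd : d ∣ n) :
    ((Finset.Icc 1 n).filter (fun a => d ∣ a * (a + 2))).card = n / d * rootCount d := by
  have hd0 := Nat.pos_of_dvd_of_pos hd hn
  rw [← count_dvd_mul hd0, Nat.mul_div_cancel' hd, Nat.count_eq_card_filter_range]
  have h0 : d ∣ n * (n + 2) := hd.mul_right _
  refine Finset.card_nbij' (fun a => if a = n then 0 else a) (fun a => if a = 0 then n else a)
    ?_ ?_ ?_ ?_
  all_goals
    intro a ha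
    simp only [Finset.coe_filter, Finset.mem_Icc, Finset.mem_range, Set.mem_ofPred_eq] at ha ⊢
    split_ifs <;> simp_all <;> grind

theorem coprime_indicator {n : ℕ} (hn : 0 < n) (a : ℕ) :
    (if Nat.gcd a n = 1 ∧ Nat.gcd (a + 2) n = 1 then 1 else 0 : ℤ) =
      ∑ d ∈ n.divisors, if d ∣ a * (a + 2) then ArithmeticFunction.moebius d else 0 := by
  have hdiv : n.divisors.filter (· ∣ a * (a + 2)) = (Nat.gcd (a * (a + 2)) n).divisors := by
    ext d
    simp [Nat.dvd_gcd_iff, hn.ne', and_comm]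
  rw [← Finset.sum_filter, hdiv, ← ArithmeticFunction.coe_mul_zeta_apply,
    ArithmeticFunction.moebius_mul_coe_zeta, ArithmeticFunction.one_apply]
  exact if_congr Nat.coprime_mul_iff_left.symm rfl rfl

theorem phi2_eq_sum_rootCount {n : ℕ} (hn : 0 < n) :
    (phi2 n : ℤ) =
      ∑ d ∈ n.divisors, ArithmeticFunction.moebius d * ((n / d * rootCount d : ℕ) : ℤ) := by
  unfold phi2
  rw [Finset.card_filter]
  push_cast
  simp_rw [coprime_indicator hn]
  rw [Finset.sum_comm]
  refine Finset.sum_congr rfl fun d hd => ?_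
  rw [← Finset.sum_filter, Finset.sum_const,
    card_Icc_filter_dvd hn (Nat.dvd_of_mem_divisors hd)]
  simp [mul_comm]

theorem moebius_mul_rootCount (d : ℕ) :
    ArithmeticFunction.moebius d * (rootCount d : ℤ) = mu2 d := by
  unfold mu2
  by_cases hd : Squarefree d
  · simp [rootCount_of_squarefree hd]
  · simp [ArithmeticFunction.moebius_eq_zero_of_not_squarefree hd]

/-- `φ₂(n) = n ∑_{d ∣ n} μ₂(d)/d`. -/
theorem phi2_eq_divisor_sum (n : ℕ) (hn : 0 < n) :
    (phi2 n : ℚ) = n * ∑ d ∈ n.divisors, (mu2 d : ℚ) / d := by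
  rw [← Int.cast_natCast (phi2 n), phi2_eq_sum_rootCount hn, Int.cast_sum, Finset.mul_sum]
  refine Finset.sum_congr rfl fun d hd => ?_
  have hdn := Nat.dvd_of_mem_divisors hd
  have hd0 : (d : ℚ) ≠ 0 := Nat.cast_ne_zero.2 (Nat.pos_of_dvd_of_pos hdn hn).ne'
  rw [← moebius_mul_rootCount, Nat.cast_mul, Int.cast_mul, Int.cast_mul, Int.cast_mul,
    Int.cast_natCast, Int.cast_natCast, Nat.cast_div hdn hd0]
  ring
end

section
/- For every positive integer n, the divisor sum ∑_{d | n} μ₂(d) equals 0 if n is even, and equals (−1)^{ω(n)} if n is odd, where ω(n) is the number of distinct prime divisors of n. -/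
theorem mu2_eq_zero_of_not_squarefree {n : ℕ} (hn : ¬Squarefree n) : mu2 n = 0 := by
  rw [mu2, ArithmeticFunction.moebius_eq_zero_of_not_squarefree hn, zero_mul]

theorem mu2_prod_primes (s : Finset ℕ) (hs : ∀ p ∈ s, p.Prime) :
    mu2 (∏ p ∈ s, p) = ∏ p ∈ s, if p = 2 then (-1 : ℤ) else -2 := by
  have hmoebius : ArithmeticFunction.moebius (∏ p ∈ s, p) = ∏ p ∈ s, (-1 : ℤ) := by
    have h := ArithmeticFunction.isMultiplicative_moebius.map_prod_of_subset_primeFactors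
      (∏ p ∈ s, p) s (Nat.primeFactors_prod hs).ge
    rw [h]
    exact Finset.prod_congr rfl fun p hp ↦ ArithmeticFunction.moebius_apply_prime (hs p hp)
  rw [mu2, hmoebius, Nat.primeFactors_prod hs, ← Finset.prod_const, Finset.prod_filter,
    ← Finset.prod_mul_distrib]
  refine Finset.prod_congr rfl fun p _ ↦ ?_
  by_cases h : p = 2 <;> simp [h]

theorem sum_divisors_mu2_eq_prod {n : ℕ} (hn : n ≠ 0) :
    ∑ d ∈ n.divisors, mu2 d = ∏ p ∈ n.primeFactors, if p = 2 then (0 : ℤ) else -1 := by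
  calc
    ∑ d ∈ n.divisors, mu2 d = ∑ d ∈ n.divisors with Squarefree d, mu2 d := by
      refine (Finset.sum_filter_of_ne fun d _ hd ↦ ?_).symm
      exact not_imp_comm.mp mu2_eq_zero_of_not_squarefree hd
    _ = ∑ s ∈ n.primeFactors.powerset, mu2 (∏ p ∈ s, p) := by
      rw [Nat.sum_divisors_filter_squarefree hn, Nat.factors_eq]
      exact Finset.sum_congr rfl fun s _ ↦ by rw [s.prod_val]; rfl
    _ = ∑ s ∈ n.primeFactors.powerset, ∏ p ∈ s, if p = 2 then (-1 : ℤ) else -2 :=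
      Finset.sum_congr rfl fun s hs ↦ mu2_prod_primes s fun _ hp ↦
        Nat.prime_of_mem_primeFactors (Finset.mem_powerset.mp hs hp)
    _ = ∏ p ∈ n.primeFactors, if p = 2 then (0 : ℤ) else -1 := by
      rw [← Finset.prod_one_add]
      refine Finset.prod_congr rfl fun p _ ↦ ?_
      split_ifs <;> norm_num

/-- `∑_{d ∣ n} μ₂(d)` is `0` for even `n` and `(-1)^{ω(n)}` for odd `n`. -/
theorem mu2_divisor_sum (n : ℕ) (hn : 0 < n) :
    ∑ d ∈ n.divisors, mu2 d =
      if Even n then 0 else (-1 : ℤ) ^ n.primeFactors.card := by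
  rw [sum_divisors_mu2_eq_prod hn.ne']
  split_ifs with h
  · exact Finset.prod_eq_zero
      (Nat.mem_primeFactors.mpr ⟨Nat.prime_two, h.two_dvd, hn.ne'⟩) (if_pos rfl)
  · rw [← Finset.prod_const]
    refine Finset.prod_congr rfl fun p hp ↦ if_neg ?_
    rintro rfl
    exact h (even_iff_two_dvd.mpr (Nat.dvd_of_mem_primeFactors hp))
end

section
/- For every complex number s with Re(s) > 1, the Dirichlet series ∑_{n=1}^∞ μ₂(n)/n^s converges absolutely and its sum equals (1 − 1/2^s) · ∏_{p odd prime} (1 − 2/p^s), where the product runs over all odd primes. -/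
open Complex

/-- A nonzero natural number with `k` distinct prime divisors has at least `2 ^ k` divisors. -/
theorem two_pow_card_primeFactors_le_card_divisors {n : ℕ} (hn : n ≠ 0) :
    2 ^ n.primeFactors.card ≤ n.divisors.card := by
  rw [Nat.card_divisors hn]
  refine Finset.pow_card_le_prod _ _ _ fun p hp => ?_
  have := (Nat.prime_of_mem_primeFactors hp).factorization_pos_of_dvd hn
    (Nat.dvd_of_mem_primeFactors hp)
  omega

theorem abs_mu2_le_card_divisors (n : ℕ) : |mu2 n| ≤ n.divisors.card := by
  rcases eq_or_ne n 0 with rfl | hn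
  · simp [mu2]
  have h : (2 : ℤ) ^ (n.primeFactors.filter (· ≠ 2)).card ≤ n.divisors.card := by
    exact_mod_cast (Nat.pow_le_pow_right two_pos (Finset.card_filter_le _ _)).trans
      (two_pow_card_primeFactors_le_card_divisors hn)
  rw [mu2, abs_mul, abs_pow, abs_two]
  exact (mul_le_of_le_one_left (by positivity) ArithmeticFunction.abs_moebius_le_one).trans h

theorem mu2_zero : mu2 0 = 0 := by simp [mu2]

theorem mu2_one : mu2 1 = 1 := by simp [mu2]

theorem mu2_two : mu2 2 = -1 := by
  simp [mu2, ArithmeticFunction.moebius_apply_prime Nat.prime_two, Nat.prime_two.primeFactors,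
    Finset.filter_singleton]

theorem mu2_prime {p : ℕ} (hp : p.Prime) (h2 : p ≠ 2) : mu2 p = -2 := by
  simp [mu2, ArithmeticFunction.moebius_apply_prime hp, hp.primeFactors,
    Finset.filter_singleton, h2]

theorem mu2_prime_pow {p k : ℕ} (hp : p.Prime) (hk : 2 ≤ k) : mu2 (p ^ k) = 0 := by
  rw [mu2, ArithmeticFunction.moebius_apply_prime_pow hp (by omega), if_neg (by omega), zero_mul]

theorem mu2_mul_of_coprime {m n : ℕ} (h : m.Coprime n) : mu2 (m * n) = mu2 m * mu2 n := by
  rw [mu2, ArithmeticFunction.isMultiplicative_moebius.map_mul_of_coprime h, h.primeFactors_mul,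
    Finset.filter_union, Finset.card_union_of_disjoint
      (Finset.disjoint_filter_filter h.disjoint_primeFactors), pow_add, mu2, mu2]
  ring

theorem summable_norm_mu2_div_cpow {s : ℂ} (hs : 1 < s.re) :
    Summable (fun n : ℕ => ‖(mu2 n : ℂ) / (n : ℂ) ^ s‖) := by
  have h1 := LSeriesSummable_one_iff.mpr hs
  refine (h1.convolution h1).norm.of_nonneg_of_le (fun _ => norm_nonneg _) fun n => ?_
  have hterm : (mu2 n : ℂ) / (n : ℂ) ^ s = LSeries.term (fun n => (mu2 n : ℂ)) s n := by
    rcases eq_or_ne n 0 with rfl | hn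
    · simp [mu2_zero]
    · rw [LSeries.term_of_ne_zero hn]
  rw [hterm]
  refine LSeries.norm_term_le s ?_
  have h : |(mu2 n : ℝ)| ≤ n.divisors.card := by exact_mod_cast abs_mu2_le_card_divisors n
  simpa [LSeries.convolution_def, ← Nat.map_div_right_divisors] using h

theorem tsum_mu2_prime_pow {p : ℕ} (hp : p.Prime) (s : ℂ) :
    ∑' e : ℕ, (mu2 (p ^ e) : ℂ) / ((p ^ e : ℕ) : ℂ) ^ s = 1 + (mu2 p : ℂ) / (p : ℂ) ^ s := by
  rw [tsum_eq_sum (s := Finset.range 2)]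
  · simp [Finset.sum_range_succ, mu2_one]
  · intro e he
    rw [mu2_prime_pow hp (by simpa [Nat.lt_iff_add_one_le] using he)]
    simp

theorem hasProd_mu2 {s : ℂ} (hs : 1 < s.re) :
    HasProd (Set.mulIndicator {p : ℕ | p.Prime} fun p => 1 + (mu2 p : ℂ) / (p : ℂ) ^ s)
      (∑' n : ℕ, (mu2 n : ℂ) / (n : ℂ) ^ s) := by
  have h := EulerProduct.eulerProduct_hasProd_mulIndicator
    (f := fun n : ℕ => (mu2 n : ℂ) / (n : ℂ) ^ s) (by simp [mu2_one])
    (fun {m n} hmn => by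
      rw [mu2_mul_of_coprime hmn, Nat.cast_mul, natCast_mul_natCast_cpow]
      push_cast
      rw [mul_div_mul_comm])
    (summable_norm_mu2_div_cpow hs) (by simp [mu2_zero])
  convert h using 1
  refine Set.mulIndicator_congr fun p hp => ?_
  exact (tsum_mu2_prime_pow hp s).symm

theorem hasProd_mulIndicator_two (s : ℂ) :
    HasProd (Set.mulIndicator ({2} : Set ℕ) fun p : ℕ => 1 + (mu2 p : ℂ) / (p : ℂ) ^ s)
      (1 - 1 / 2 ^ s) := by
  have h := hasProd_single
    (f := Set.mulIndicator ({2} : Set ℕ) fun p : ℕ => 1 + (mu2 p : ℂ) / (p : ℂ) ^ s) 2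
    fun p hp => Set.mulIndicator_of_notMem (s := ({2} : Set ℕ)) hp _
  rw [Set.mulIndicator_of_mem (Set.mem_singleton 2), mu2_two] at h
  convert h using 1
  push_cast
  ring

theorem hasProd_mulIndicator_odd_primes {s : ℂ} (hs : 1 < s.re) :
    HasProd (Set.mulIndicator {p : ℕ | p.Prime ∧ p ≠ 2} fun p => 1 + (mu2 p : ℂ) / (p : ℂ) ^ s)
      (∏' p : {p : ℕ // p.Prime ∧ p ≠ 2}, (1 - 2 / ((p : ℕ) : ℂ) ^ s)) := by
  rw [← hasProd_subtype_iff_mulIndicator]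
  have hodd : Multipliable fun p : {p : ℕ // p.Prime ∧ p ≠ 2} =>
      1 + (mu2 p : ℂ) / ((p : ℕ) : ℂ) ^ s :=
    multipliable_one_add_of_summable
      ((summable_norm_mu2_div_cpow hs).comp_injective Subtype.val_injective)
  have hval : ∀ p : {p : ℕ // p.Prime ∧ p ≠ 2},
      1 + (mu2 p : ℂ) / ((p : ℕ) : ℂ) ^ s = 1 - 2 / ((p : ℕ) : ℂ) ^ s := fun p => by
    rw [mu2_prime p.2.1 p.2.2]
    push_cast
    ring
  rw [← tprod_congr hval]
  exact hodd.hasProd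

theorem mulIndicator_primes_eq_mul {M : Type*} [MulOneClass M] (f : ℕ → M) (p : ℕ) :
    Set.mulIndicator {p : ℕ | p.Prime} f p =
      Set.mulIndicator {2} f p * Set.mulIndicator {p : ℕ | p.Prime ∧ p ≠ 2} f p := by
  by_cases hp : p = 2
  · simp [hp, Set.mulIndicator, Nat.prime_two]
  · simp [hp, Set.mulIndicator]

/-- for `Re(s) > 1`, the Dirichlet series of `μ₂` converges absolutely and
`∑_{n ≥ 1} μ₂(n)/n^s = (1 - 1/2^s) ∏_{p odd prime} (1 - 2/p^s)`.
(The `n = 0` term of the sum vanishes since `μ₂ 0 = 0`.) -/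
theorem mu2_dirichlet_series (s : ℂ) (hs : 1 < s.re) :
    Summable (fun n : ℕ => ‖(mu2 n : ℂ) / (n : ℂ) ^ s‖) ∧
    ∑' n : ℕ, (mu2 n : ℂ) / (n : ℂ) ^ s =
      (1 - 1 / 2 ^ s) *
        ∏' p : {p : ℕ // p.Prime ∧ p ≠ 2}, (1 - 2 / ((p : ℕ) : ℂ) ^ s) := by
  refine ⟨summable_norm_mu2_div_cpow hs, (hasProd_mu2 hs).unique ?_⟩
  rw [funext (mulIndicator_primes_eq_mul fun p : ℕ => 1 + (mu2 p : ℂ) / (p : ℂ) ^ s)]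
  exact (hasProd_mulIndicator_two s).mul (hasProd_mulIndicator_odd_primes hs)
end

section
/- For every complex number s with Re(s) > 2, the Dirichlet series ∑_{n=1}^∞ φ₂(n)/n^s converges absolutely and satisfies ∑_{n=1}^∞ φ₂(n)/n^s = ζ(s−1) · ∑_{n=1}^∞ μ₂(n)/n^s, where ζ is the Riemann zeta function. -/
open Complex

open ArithmeticFunction in
/-- Möbius detects coprimality. -/
theorem sum_moebius_filter_dvd_eq_ite_coprime {n : ℕ} (hn : n ≠ 0) (m : ℕ) :
    ∑ d ∈ n.divisors with d ∣ m, moebius d = if m.Coprime n then 1 else 0 := by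
  have hset : n.divisors.filter (· ∣ m) = (m.gcd n).divisors := by
    ext d
    simp [Nat.dvd_gcd_iff, hn, and_comm]
  have h := congrArg (fun f : ArithmeticFunction ℤ => f (m.gcd n)) moebius_mul_coe_zeta
  simp only [coe_mul_zeta_apply, one_apply] at h
  rw [hset, h]

/-- For squarefree `d`, the congruence `x (x + 2) ≡ 0 [MOD d]` has `2 ^ ω_o(d)` solutions. -/
theorem card_zmod_mul_add_two_eq_zero {d : ℕ} (hd : Squarefree d) :
    Nat.card {x : ZMod d // x * (x + 2) = 0} = 2 ^ (d.primeFactors.filter (· ≠ 2)).card := by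
  induction d using Nat.recOnPosPrimePosCoprime with
  | zero => exact absurd hd not_squarefree_zero
  | one =>
    simp only [Nat.primeFactors_one, Finset.filter_empty, Finset.card_empty, pow_zero]
    exact Nat.card_eq_one_iff_unique.mpr ⟨inferInstance, ⟨0, Subsingleton.elim _ _⟩⟩
  | prime_pow p k hp hk =>
    obtain rfl : k = 1 := ((Nat.squarefree_pow_iff hp.ne_one hk.ne').mp hd).2
    rw [pow_one, hp.primeFactors]
    have := Fact.mk hp
    have hset : {x : ZMod p | x * (x + 2) = 0} = {0, -2} := by
      ext x
      simp [eq_neg_iff_add_eq_zero]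
    change Nat.card ↥{x : ZMod p | x * (x + 2) = 0} = _
    rw [Nat.card_coe_set_eq, hset]
    by_cases h2 : p = 2
    · subst h2
      rw [show (-2 : ZMod 2) = 0 from neg_eq_zero.mpr (by exact_mod_cast ZMod.natCast_self 2), Set.pair_eq_singleton, Set.ncard_singleton,
        Finset.filter_singleton]
      simp
    · have h0 : (0 : ZMod p) ≠ -2 := by
        intro h
        have h' : ((2 : ℕ) : ZMod p) = 0 := by
          simpa using (neg_eq_zero.mp h.symm)
        exact h2 ((Nat.prime_dvd_prime_iff_eq hp Nat.prime_two).mp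
          ((ZMod.natCast_eq_zero_iff _ _).mp h'))
      rw [Set.ncard_pair h0, Finset.filter_singleton]
      simp [h2]
  | coprime a b ha hb hab iha ihb =>
    obtain ⟨-, hsa, hsb⟩ := Nat.squarefree_mul_iff.mp hd
    rw [hab.primeFactors_mul, Finset.filter_union, Finset.card_union_of_disjoint
      (Finset.disjoint_filter_filter hab.disjoint_primeFactors), pow_add, ← iha hsa, ← ihb hsb,
      ← Nat.card_prod]
    refine Nat.card_congr (((ZMod.chineseRemainder hab).toEquiv.subtypeEquiv fun x => ?_).trans
      (Equiv.subtypeProdEquivProd (p := fun x : ZMod a => x * (x + 2) = 0)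
        (q := fun x : ZMod b => x * (x + 2) = 0)))
    rw [← map_eq_zero_iff _ (ZMod.chineseRemainder hab).injective, map_mul, map_add, map_ofNat,
      Prod.ext_iff]
    rfl

/-- Each of the `k` periods contributes equally to the count of solutions of a periodic
predicate. -/
theorem card_filter_Ico_mul_of_periodic {p : ℕ → Prop} [DecidablePred p] {d : ℕ}
    (hp : Function.Periodic p d) (m k : ℕ) :
    ((Finset.Ico m (m + d * k)).filter p).card = k * d.count p := by
  induction k with
  | zero => simp
  | succ k ih =>
    rw [← Finset.Ico_union_Ico_eq_Ico (b := m + d * k) (by omega) (by gcongr; omega),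
      Finset.filter_union, Finset.card_union_of_disjoint
        (Finset.disjoint_filter_filter (Finset.Ico_disjoint_Ico_consecutive _ _ _)), ih,
      mul_add_one, ← add_assoc, Nat.filter_Ico_card_eq_of_periodic _ _ _ hp, add_one_mul]

theorem count_dvd_mul_add_two {d : ℕ} (hd : d ≠ 0) :
    d.count (fun a => d ∣ a * (a + 2)) = Nat.card {x : ZMod d // x * (x + 2) = 0} := by
  have := NeZero.mk hd
  have hcast (a : ℕ) : d ∣ a * (a + 2) ↔ (a : ZMod d) * (a + 2) = 0 := by
    rw [← ZMod.natCast_eq_zero_iff]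
    push_cast
    rfl
  rw [Nat.count_eq_card_filter_range, Nat.card_eq_fintype_card, Fintype.card_subtype]
  refine Finset.card_bij' (fun a _ => (a : ZMod d)) (fun x _ => x.val) ?_ ?_ ?_ ?_
  · intro a ha
    simpa [hcast] using (Finset.mem_filter.mp ha).2
  · intro x hx
    simpa [hcast, ZMod.val_lt] using hx
  · intro a ha
    exact ZMod.val_cast_of_lt (by simpa using (Finset.mem_filter.mp ha).1)
  · intro x _
    exact ZMod.natCast_zmod_val x

theorem moebius_mul_card_dvd_mul_add_two {d k : ℕ} (hd : d ≠ 0) :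
    ArithmeticFunction.moebius d *
      (((Finset.Icc 1 (d * k)).filter (fun a => d ∣ a * (a + 2))).card : ℤ) = mu2 d * k := by
  by_cases hsq : Squarefree d
  · have hper : Function.Periodic (fun a => d ∣ a * (a + 2)) d := fun a => by
      simp only [eq_iff_iff, ← ZMod.natCast_eq_zero_iff]
      simp
    have hIco : Finset.Icc 1 (d * k) = Finset.Ico 1 (1 + d * k) := by
      ext
      simp
      omega
    rw [hIco, card_filter_Ico_mul_of_periodic hper, count_dvd_mul_add_two hd,
      card_zmod_mul_add_two_eq_zero hsq, mu2]
    push_cast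
    ring
  · simp [mu2, ArithmeticFunction.moebius_eq_zero_of_not_squarefree hsq]

theorem phi2_eq_sum_divisorsAntidiagonal {n : ℕ} (hn : n ≠ 0) :
    (phi2 n : ℤ) = ∑ p ∈ n.divisorsAntidiagonal, (p.1 : ℤ) * mu2 p.2 := by
  have hcop (a : ℕ) : (Nat.gcd a n = 1 ∧ Nat.gcd (a + 2) n = 1) ↔ (a * (a + 2)).Coprime n :=
    Nat.coprime_mul_iff_left.symm
  simp only [phi2, hcop, Finset.card_filter, Nat.cast_sum, Nat.cast_ite, Nat.cast_one,
    Nat.cast_zero, ← sum_moebius_filter_dvd_eq_ite_coprime hn, Finset.sum_filter]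
  rw [Finset.sum_comm, ← Nat.sum_divisorsAntidiagonal' (fun _ d => ∑ a ∈ Finset.Icc 1 n,
    if d ∣ a * (a + 2) then ArithmeticFunction.moebius d else 0)]
  refine Finset.sum_congr rfl fun p hp => ?_
  obtain ⟨rfl, -⟩ := Nat.mem_divisorsAntidiagonal.mp hp
  rw [← Finset.sum_filter, Finset.sum_const, nsmul_eq_mul, mul_comm, mul_comm p.1,
    moebius_mul_card_dvd_mul_add_two (right_ne_zero_of_mul hn), mul_comm]

open scoped LSeries.notation

theorem LSeriesSummable_mu2 {s : ℂ} (hs : 1 < s.re) :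
    LSeriesSummable (fun n => (mu2 n : ℂ)) s := by
  have h1 : LSeriesSummable 1 s := LSeriesSummable_one_iff.mpr hs
  refine Summable.of_norm_bounded (h1.convolution h1).norm fun n => ?_
  refine LSeries.norm_term_le s ?_
  rw [LSeries.convolution_def]
  have h := abs_mu2_le_card_divisors n
  simp only [Pi.one_apply, mul_one, Finset.sum_const, nsmul_eq_mul, Complex.norm_natCast,
    Complex.norm_intCast]
  rw [← Nat.map_div_right_divisors, Finset.card_map]
  exact_mod_cast h

theorem term_natCast_eq_term_one_sub_one (s : ℂ) :
    LSeries.term (fun n => (n : ℂ)) s = LSeries.term 1 (s - 1) := by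
  ext n
  rcases eq_or_ne n 0 with rfl | hn
  · simp
  · have hn' : (n : ℂ) ≠ 0 := Nat.cast_ne_zero.mpr hn
    rw [LSeries.term_of_ne_zero hn, LSeries.term_of_ne_zero hn, cpow_sub _ _ hn', cpow_one]
    simp

theorem LSeriesHasSum_natCast {s : ℂ} (hs : 2 < s.re) :
    LSeriesHasSum (fun n => (n : ℂ)) s (riemannZeta (s - 1)) := by
  rw [LSeriesHasSum, term_natCast_eq_term_one_sub_one]
  exact LSeriesHasSum_one (by rw [sub_re, one_re]; linarith)

/-- for `Re(s) > 2`, the Dirichlet series of `φ₂` converges absolutely and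
`∑_{n ≥ 1} φ₂(n)/n^s = ζ(s-1) ∑_{n ≥ 1} μ₂(n)/n^s`.
(The `n = 0` terms vanish since `φ₂ 0 = 0` and `μ₂ 0 = 0`.) -/
theorem phi2_dirichlet_series (s : ℂ) (hs : 2 < s.re) :
    Summable (fun n : ℕ => ‖(phi2 n : ℂ) / (n : ℂ) ^ s‖) ∧
    ∑' n : ℕ, (phi2 n : ℂ) / (n : ℂ) ^ s =
      riemannZeta (s - 1) * ∑' n : ℕ, (mu2 n : ℂ) / (n : ℂ) ^ s := by
  have hs0 : s ≠ 0 := by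
    rintro rfl
    norm_num at hs
  have hterm (f : ℕ → ℂ) : (fun n : ℕ => f n / (n : ℂ) ^ s) = LSeries.term f s :=
    funext fun n => (LSeries.term_of_ne_zero' hs0 f n).symm
  have hmu := LSeriesSummable_mu2 (s := s) (by linarith)
  have hconv : LSeries.term (fun n => (phi2 n : ℂ)) s =
      LSeries.term ((fun n => (n : ℂ)) ⍟ (fun n => (mu2 n : ℂ))) s := by
    ext n
    refine LSeries.term_congr (fun {n} hn => ?_) s n
    rw [LSeries.convolution_def]
    simpa using congrArg (Int.cast : ℤ → ℂ) (phi2_eq_sum_divisorsAntidiagonal hn)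
  have hsum := (LSeriesHasSum_natCast hs).convolution hmu.LSeriesHasSum
  rw [LSeriesHasSum, ← hconv] at hsum
  refine ⟨?_, ?_⟩
  · rw [← hterm] at hsum
    exact hsum.summable.norm
  · rw [hterm (fun n => (phi2 n : ℂ)), hterm (fun n => (mu2 n : ℂ)), hsum.tsum_eq]
    rfl
end

section
/- For every real x ≥ 1, ∑_{n ≤ x} μ₂(n)·⌊x/n⌋ = L(x) + L(x/2) + 2·L(x/4) + 4·L(x/8) + ⋯ = L(x) + ∑_{k ≥ 1} 2^{k−1}·L(x/2^k), where L(y) := ∑_{n ≤ y} (−1)^{ω(n)} for y ≥ 1 and L(y) := 0 for 0 < y < 1 (so the sum over k has only finitely many nonzero terms). -/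
/-- `L(y) = ∑_{n ≤ y} (-1)^{ω(n)}` (equal to `0` for `y < 1`). -/
noncomputable def Lfun (y : ℝ) : ℤ :=
  ∑ n ∈ Finset.Icc 1 ⌊y⌋₊, (-1 : ℤ) ^ n.primeFactors.card

open Finset in
theorem mu2_eq_prod_primeFactors {n : ℕ} (hn : Squarefree n) :
    mu2 n = ∏ p ∈ n.primeFactors, if p = 2 then (-1 : ℤ) else -2 := by
  have hcard : ArithmeticFunction.cardFactors n = #n.primeFactors :=
    ((ArithmeticFunction.cardDistinctFactors_eq_cardFactors_iff_squarefree hn.ne_zero).2 hn).symm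
  have hsplit (p : ℕ) :
      (if p = 2 then (-1 : ℤ) else -2) = -1 * if p ≠ 2 then 2 else 1 := by
    split_ifs <;> simp_all
  rw [mu2, ArithmeticFunction.moebius_apply_of_squarefree hn, hcard]
  simp_rw [hsplit]
  rw [prod_mul_distrib, prod_const, ← prod_filter, prod_const]

open Finset in
theorem sum_divisors_mu2 {n : ℕ} (hn : n ≠ 0) :
    ∑ d ∈ n.divisors, mu2 d = if Odd n then (-1 : ℤ) ^ #n.primeFactors else 0 := by
  have hsq : ∑ d ∈ n.divisors, mu2 d = ∑ d ∈ n.divisors with Squarefree d, mu2 d := by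
    refine (sum_filter_of_ne fun d _ hd ↦ ?_).symm
    rw [← ArithmeticFunction.moebius_ne_zero_iff_squarefree]
    exact left_ne_zero_of_mul hd
  have hprod : ∑ d ∈ n.divisors, mu2 d =
      ∏ p ∈ n.primeFactors, (1 + if p = 2 then (-1 : ℤ) else -2) := by
    rw [hsq, sum_congr rfl fun d hd ↦ mu2_eq_prod_primeFactors (mem_filter.1 hd).2,
      Nat.sum_divisors_filter_squarefree hn, Nat.factors_eq, prod_one_add]
    refine sum_congr rfl fun t ht ↦ ?_
    have hp : ∀ p ∈ t, p.Prime := fun p hp ↦ Nat.prime_of_mem_primeFactors (mem_powerset.1 ht hp)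
    rw [prod_val, ← Nat.primeFactors_prod hp]
    simp [Nat.primeFactors_prod hp]
  rw [hprod]
  split_ifs with hodd
  · rw [← prod_const]
    refine prod_congr rfl fun p hp ↦ ?_
    have : p ≠ 2 := by
      rintro rfl
      exact hodd.not_two_dvd_nat (Nat.dvd_of_mem_primeFactors hp)
    simp [this]
  · refine prod_eq_zero (i := 2) ?_ (by simp)
    exact Nat.mem_primeFactors.2 ⟨Nat.prime_two, (Nat.not_odd_iff_even.1 hodd).two_dvd, hn⟩

open Finset in
theorem sum_mu2_mul_div (N : ℕ) :
    ∑ n ∈ Icc 1 N, mu2 n * ((N / n : ℕ) : ℤ) =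
      ∑ n ∈ Icc 1 N, if Odd n then (-1 : ℤ) ^ #n.primeFactors else 0 := by
  let f : ArithmeticFunction ℤ := ⟨mu2, by simp [mu2]⟩
  have h := ArithmeticFunction.sum_Ioc_mul_zeta_eq_sum f N
  change ∑ n ∈ Icc 1 N, _ = ∑ n ∈ Icc 1 N, _ at h
  refine h.symm.trans (sum_congr rfl fun n hn ↦ ?_)
  rw [ArithmeticFunction.coe_mul_zeta_apply]
  exact sum_divisors_mu2 (by grind)

open Finset in
theorem card_primeFactors_two_mul (m : ℕ) (hm : m ≠ 0) :
    #(2 * m).primeFactors = if Odd m then #m.primeFactors + 1 else #m.primeFactors := by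
  rw [Nat.primeFactors_mul two_ne_zero hm, Nat.prime_two.primeFactors, ← insert_eq]
  have h2 : 2 ∈ m.primeFactors ↔ ¬ Odd m := by
    simp [hm, Nat.prime_two, even_iff_two_dvd]
  split_ifs with h
  · exact card_insert_of_notMem (by tauto)
  · rw [insert_eq_of_mem (h2.2 h)]

open Finset in
theorem sum_neg_one_pow_card_primeFactors_half (N : ℕ) :
    ∑ n ∈ Icc 1 N, (-1 : ℤ) ^ #n.primeFactors =
      ∑ n ∈ Icc 1 (N / 2), (-1 : ℤ) ^ #n.primeFactors +
      (∑ n ∈ Icc 1 N, if Odd n then (-1 : ℤ) ^ #n.primeFactors else 0) -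
      2 * ∑ n ∈ Icc 1 (N / 2), if Odd n then (-1 : ℤ) ^ #n.primeFactors else 0 := by
  induction N with
  | zero => simp
  | succ N ih =>
    rcases Nat.even_or_odd' N with ⟨m, rfl | rfl⟩
    · rw [sum_Icc_succ_top (by lia), sum_Icc_succ_top (by lia), ih,
        show (2 * m + 1) / 2 = 2 * m / 2 by lia, if_pos (odd_two_mul_add_one m)]
      ring
    · have hodd : ¬ Odd (2 * m + 1 + 1) := by grind
      rw [sum_Icc_succ_top (b := 2 * m + 1) (by lia), sum_Icc_succ_top (b := 2 * m + 1) (by lia), ih,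
        if_neg hodd,
        show (2 * m + 1 + 1) / 2 = m + 1 by lia, show (2 * m + 1) / 2 = m by lia,
        sum_Icc_succ_top (b := m) (by lia), sum_Icc_succ_top (b := m) (by lia),
        show 2 * m + 1 + 1 = 2 * (m + 1) by ring, card_primeFactors_two_mul (m + 1) (by lia)]
      split_ifs <;> ring

open Finset in
theorem sum_add_sum_range_dyadic (N K : ℕ) :
    ∑ n ∈ Icc 1 N, (-1 : ℤ) ^ #n.primeFactors +
      ∑ k ∈ range K, 2 ^ k * ∑ n ∈ Icc 1 (N / 2 ^ (k + 1)), (-1 : ℤ) ^ #n.primeFactors =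
    (∑ n ∈ Icc 1 N, if Odd n then (-1 : ℤ) ^ #n.primeFactors else 0) +
      2 ^ K * (∑ n ∈ Icc 1 (N / 2 ^ K), (-1 : ℤ) ^ #n.primeFactors -
        ∑ n ∈ Icc 1 (N / 2 ^ K), if Odd n then (-1 : ℤ) ^ #n.primeFactors else 0) := by
  induction K with
  | zero => simp
  | succ K ih =>
    rw [sum_range_succ, ← add_assoc, ih, sum_neg_one_pow_card_primeFactors_half (N / 2 ^ K),
      Nat.div_div_eq_div_mul, ← pow_succ]
    ring

theorem Lfun_div_two_pow (x : ℝ) (k : ℕ) :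
    Lfun (x / 2 ^ k) = ∑ n ∈ Finset.Icc 1 (⌊x⌋₊ / 2 ^ k), (-1 : ℤ) ^ n.primeFactors.card := by
  have h := Nat.floor_div_natCast x (2 ^ k)
  push_cast at h
  rw [Lfun, h]

/-- for `x ≥ 1`,
`∑_{n ≤ x} μ₂(n)⌊x/n⌋ = L(x) + L(x/2) + 2 L(x/4) + 4 L(x/8) + ⋯`,
i.e. `= L(x) + ∑_{k ≥ 1} 2^{k-1} L(x/2^k)` (a sum with finitely many nonzero terms). -/
theorem mu2_weighted_average (x : ℝ) (hx : 1 ≤ x) :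
    ∑ n ∈ Finset.Icc 1 ⌊x⌋₊, mu2 n * ⌊x / (n : ℝ)⌋ =
      Lfun x + ∑' k : ℕ, 2 ^ k * Lfun (x / 2 ^ (k + 1)) := by
  have hlhs : ∑ n ∈ Finset.Icc 1 ⌊x⌋₊, mu2 n * ⌊x / (n : ℝ)⌋ =
      ∑ n ∈ Finset.Icc 1 ⌊x⌋₊, mu2 n * ((⌊x⌋₊ / n : ℕ) : ℤ) := by
    refine Finset.sum_congr rfl fun n _ ↦ ?_
    rw [Int.floor_div_natCast, Int.natCast_div, Int.natCast_floor_eq_floor (by linarith)]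
  have hpow : ∀ k, ⌊x⌋₊ ≤ k → ⌊x⌋₊ / 2 ^ k = 0 := fun k hk ↦
    Nat.div_eq_of_lt (hk.trans_lt k.lt_two_pow_self)
  have hsum : ∑' k : ℕ, 2 ^ k * Lfun (x / 2 ^ (k + 1)) =
      ∑ k ∈ Finset.range ⌊x⌋₊, 2 ^ k * Lfun (x / 2 ^ (k + 1)) := by
    refine tsum_eq_sum fun k hk ↦ ?_
    rw [Lfun_div_two_pow, hpow (k + 1) (by grind)]
    simp
  have hL : Lfun x = ∑ n ∈ Finset.Icc 1 ⌊x⌋₊, (-1 : ℤ) ^ n.primeFactors.card := rfl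
  simp_rw [hlhs, hsum, sum_mu2_mul_div, Lfun_div_two_pow, hL, sum_add_sum_range_dyadic,
    hpow _ le_rfl]
  simp
end
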